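/- Let $E$ be a Banach lattice and $M$ a positive uniformly bounded subset of $E$ such that the convex hull of $M$ is a closed subset of $E_{\overline{M}}$ with respect to the $p_{\overline{M}}$-norm. Then $C_M = \overline{M}$, $E_M = E_{\overline{M}}$, $p_M = p_{\overline{M}}$, and hence $(E_M, p_M)$ is a Banach lattice. -/

import Mathlib

open scoped BigOperators

section MajorizedDefs

variable {E : Type*} [AddCommGroup E] [PartialOrder E] [Module ℝ E]

/-- `M` is a *positive subset* of the ordered vector space `E`: it is nonempty, contained in
the positive cone, and `0` does not belong to its convex hull. -/
def IsPositiveSubset (M : Set E) : Prop :=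
  M.Nonempty ∧ (∀ m ∈ M, 0 ≤ m) ∧ (0 : E) ∉ convexHull ℝ M

/-- The proper convex cone `C_M` generated by a positive subset `M`. -/
def coneGen (M : Set E) : Set E :=
  {c | ∃ (t : ℝ) (m : E), 0 ≤ t ∧ m ∈ convexHull ℝ M ∧ m ≠ 0 ∧ c = t • m}

/-- The majorized space `E_M`: all vectors `v` with `±v ≤ c` for some `c ∈ C_M`. -/
def EMaj (M : Set E) : Set E :=
  {v | ∃ c ∈ coneGen M, -v ≤ c ∧ v ≤ c}

/-- The majorizing seminorm `p_M`. -/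
noncomputable def pM (M : Set E) (v : E) : ℝ :=
  sInf {s : ℝ | ∃ (n : ℕ) (t : Fin n → ℝ) (m : Fin n → E),
    0 < n ∧ (∀ j, 0 ≤ t j) ∧ (∀ j, m j ∈ M) ∧
    (-v ≤ ∑ j, t j • m j) ∧ (v ≤ ∑ j, t j • m j) ∧ s = ∑ j, t j}

end MajorizedDefs

section MbarDefs

variable {E : Type*} [NormedAddCommGroup E] [Lattice E] [HasSolidNorm E] [IsOrderedAddMonoid E]
  [NormedSpace ℝ E]

/-- The set `M̅` of all sums of norm-convergent series `∑ t_j • m_j` with summable nonnegative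
coefficients `t_j` and terms `m_j ∈ M`. -/
def MbarSet (M : Set E) : Set E :=
  {w | ∃ (t : ℕ → ℝ) (m : ℕ → E), (∀ j, 0 ≤ t j) ∧ (∀ j, m j ∈ M) ∧
        Summable t ∧ HasSum (fun j => t j • m j) w}

/-- The space `E_{M̅}` of vectors majorized by `M̅`. -/
def EMbar (M : Set E) : Set E := {v | ∃ w ∈ MbarSet M, |v| ≤ w}

/-- The norm `p_{M̅}`. -/
noncomputable def pMbar (M : Set E) (v : E) : ℝ :=
  sInf {s : ℝ | ∃ (t : ℕ → ℝ) (m : ℕ → E) (w : E), (∀ j, 0 ≤ t j) ∧ (∀ j, m j ∈ M) ∧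
        Summable t ∧ HasSum (fun j => t j • m j) w ∧ |v| ≤ w ∧ s = ∑' j, t j}

end MbarDefs

section FiniteCombinations

open scoped Pointwise

variable {E : Type*} [AddCommGroup E] [Module ℝ E] {M : Set E}

theorem sum_smul_mem_smul_convexHull {ι : Type*} (hM : M.Nonempty) (s : Finset ι) {t : ι → ℝ}
    {m : ι → E} (ht : ∀ j, 0 ≤ t j) (hm : ∀ j, m j ∈ M) :
    ∑ j ∈ s, t j • m j ∈ (∑ j ∈ s, t j) • convexHull ℝ M := by
  classical
  induction s using Finset.induction_on with
  | empty =>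
    obtain ⟨m₀, hm₀⟩ := hM
    exact ⟨m₀, subset_convexHull ℝ M hm₀, by simp⟩
  | insert a s ha ih =>
    rw [Finset.sum_insert ha, Finset.sum_insert ha,
      (convex_convexHull ℝ M).add_smul (ht a) (Finset.sum_nonneg fun j _ => ht j)]
    exact Set.add_mem_add (Set.smul_mem_smul_set (subset_convexHull ℝ M (hm a))) ih

theorem exists_fin_sum_of_mem_smul_convexHull {s : ℝ} {w : E} (hs : 0 ≤ s)
    (hw : w ∈ s • convexHull ℝ M) :
    ∃ (n : ℕ) (t : Fin n → ℝ) (m : Fin n → E), 0 < n ∧ (∀ j, 0 ≤ t j) ∧ (∀ j, m j ∈ M) ∧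
      ∑ j, t j • m j = w ∧ ∑ j, t j = s := by
  obtain ⟨c, hc, rfl⟩ := hw
  obtain ⟨ι, _, u, z, hu, hu1, hz, rfl⟩ := mem_convexHull_iff_exists_fintype.1 hc
  have hne : Nonempty ι := by
    by_contra h
    rw [not_nonempty_iff] at h
    simp at hu1
  refine ⟨Fintype.card ι, fun j => s * u ((Fintype.equivFin ι).symm j),
    fun j => z ((Fintype.equivFin ι).symm j), Fintype.card_pos,
    fun j => mul_nonneg hs (hu _), fun j => hz _, ?_, ?_⟩
  · rw [Equiv.sum_comp (Fintype.equivFin ι).symm (fun i => (s * u i) • z i)]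
    simp only [Finset.smul_sum, mul_smul]
  · rw [Equiv.sum_comp (Fintype.equivFin ι).symm (fun i => s * u i), ← Finset.mul_sum, hu1, mul_one]

theorem smul_convexHull_subset_coneGen [PartialOrder E] (hM : IsPositiveSubset M) {s : ℝ}
    (hs : 0 ≤ s) : s • convexHull ℝ M ⊆ coneGen M := by
  rintro _ ⟨c, hc, rfl⟩
  exact ⟨s, c, hs, hc, fun h => hM.2.2 (h ▸ hc), rfl⟩

end FiniteCombinations

section SeriesSums

open scoped Pointwise

variable {E : Type*} [NormedAddCommGroup E] [NormedSpace ℝ E] {M : Set E}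

/-- `w` is the sum of a series `∑ t_j • m_j` with terms `m_j ∈ M` and nonnegative coefficients `t_j`
of total mass `s`. -/
def IsSeriesSum (M : Set E) (s : ℝ) (w : E) : Prop :=
  ∃ (t : ℕ → ℝ) (m : ℕ → E), (∀ j, 0 ≤ t j) ∧ (∀ j, m j ∈ M) ∧ HasSum t s ∧
    HasSum (fun j => t j • m j) w

theorem IsSeriesSum.nonneg {s : ℝ} {w : E} (h : IsSeriesSum M s w) : 0 ≤ s := by
  obtain ⟨t, _, ht, _, hts, _⟩ := h
  exact hts.nonneg ht

theorem IsSeriesSum.of_mem_smul_convexHull {s : ℝ} {w : E} (hs : 0 ≤ s)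
    (hw : w ∈ s • convexHull ℝ M) : IsSeriesSum M s w := by
  obtain ⟨n, t, m, hn, ht, hm, rfl, rfl⟩ := exists_fin_sum_of_mem_smul_convexHull hs hw
  have hinj : Function.Injective (Fin.val : Fin n → ℕ) := Fin.val_injective
  refine ⟨Function.extend Fin.val t 0, Function.extend Fin.val m fun _ => m ⟨0, hn⟩,
    fun j => ?_, fun j => ?_, (hasSum_extend_zero hinj).2 (hasSum_fintype t), ?_⟩
  · by_cases h : ∃ i : Fin n, i.val = j
    · obtain ⟨i, rfl⟩ := h
      simpa only [hinj.extend_apply] using ht i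
    · simp [Function.extend_apply' _ _ _ h]
  · by_cases h : ∃ i : Fin n, i.val = j
    · obtain ⟨i, rfl⟩ := h
      simpa only [hinj.extend_apply] using hm i
    · simpa only [Function.extend_apply' _ _ _ h] using hm ⟨0, hn⟩
  · convert (hasSum_extend_zero hinj).2 (hasSum_fintype fun i => t i • m i) using 2 with j
    by_cases h : ∃ i : Fin n, i.val = j
    · obtain ⟨i, rfl⟩ := h
      simp only [hinj.extend_apply]
    · simp [Function.extend_apply' _ _ _ h]

theorem IsSeriesSum.hasSum [CompleteSpace E] {C : ℝ} (hC : ∀ m ∈ M, ‖m‖ ≤ C) {s : ℕ → ℝ}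
    {w : ℕ → E} {S : ℝ} {W : E} (h : ∀ k, IsSeriesSum M (s k) (w k)) (hs : HasSum s S)
    (hw : HasSum w W) : IsSeriesSum M S W := by
  choose t m ht hm hts htm using h
  have hsum : Summable fun p : ℕ × ℕ => t p.1 p.2 := by
    rw [summable_prod_of_nonneg fun p => ht p.1 p.2]
    refine ⟨fun k => (hts k).summable, ?_⟩
    simpa only [(hts _).tsum_eq] using hs.summable
  have hsumE : Summable fun p : ℕ × ℕ => t p.1 p.2 • m p.1 p.2 := by
    refine Summable.of_norm_bounded (hsum.mul_right C) fun p => ?_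
    rw [norm_smul, Real.norm_of_nonneg (ht _ _)]
    exact mul_le_mul_of_nonneg_left (hC _ (hm _ _)) (ht _ _)
  have hS : HasSum (fun p : ℕ × ℕ => t p.1 p.2) S := by
    rw [← (hsum.hasSum.prod_fiberwise hts).unique hs]
    exact hsum.hasSum
  have hW : HasSum (fun p : ℕ × ℕ => t p.1 p.2 • m p.1 p.2) W := by
    rw [← (hsumE.hasSum.prod_fiberwise htm).unique hw]
    exact hsumE.hasSum
  obtain ⟨e⟩ : Nonempty (ℕ ≃ ℕ × ℕ) := ⟨Nat.pairEquiv.symm⟩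
  exact ⟨fun j => t (e j).1 (e j).2, fun j => m (e j).1 (e j).2, fun j => ht _ _,
    fun j => hm _ _, e.hasSum_iff.2 hS, e.hasSum_iff.2 hW⟩

theorem mem_MbarSet_iff {w : E} : w ∈ MbarSet M ↔ ∃ s, IsSeriesSum M s w := by
  constructor
  · rintro ⟨t, m, ht, hm, hts, hw⟩
    exact ⟨_, t, m, ht, hm, hts.hasSum, hw⟩
  · rintro ⟨s, t, m, ht, hm, hts, hw⟩
    exact ⟨t, m, ht, hm, hts.summable, hw⟩

end SeriesSums

section BanachLattice

open scoped Pointwise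
open Filter Topology

variable {E : Type*} [NormedAddCommGroup E] [Lattice E] [NormedSpace ℝ E] {M : Set E}

theorem pMbar_eq_sInf (M : Set E) (v : E) :
    pMbar M v = sInf {s | ∃ w, IsSeriesSum M s w ∧ |v| ≤ w} := by
  unfold pMbar
  congr 1
  ext s
  constructor
  · rintro ⟨t, m, w, ht, hm, hts, hw, hvw, rfl⟩
    exact ⟨w, ⟨t, m, ht, hm, hts.hasSum, hw⟩, hvw⟩
  · rintro ⟨w, ⟨t, m, ht, hm, hts, hw⟩, hvw⟩
    exact ⟨t, m, w, ht, hm, hts.summable, hw, hvw, hts.tsum_eq.symm⟩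

theorem pMbar_le {s : ℝ} {v w : E} (h : IsSeriesSum M s w) (hvw : |v| ≤ w) : pMbar M v ≤ s := by
  rw [pMbar_eq_sInf]
  exact csInf_le ⟨0, fun _ ⟨_, h, _⟩ => h.nonneg⟩ ⟨w, h, hvw⟩

theorem pM_eq_sInf (hM : M.Nonempty) (v : E) :
    pM M v = sInf {s | 0 ≤ s ∧ ∃ w ∈ s • convexHull ℝ M, |v| ≤ w} := by
  unfold pM
  congr 1
  ext s
  constructor
  · rintro ⟨n, t, m, -, ht, hm, hv₁, hv₂, rfl⟩
    exact ⟨Finset.sum_nonneg fun j _ => ht j, _, sum_smul_mem_smul_convexHull hM _ ht hm,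
      abs_le'.2 ⟨hv₂, hv₁⟩⟩
  · rintro ⟨hs, w, hw, hvw⟩
    obtain ⟨n, t, m, hn, ht, hm, rfl, rfl⟩ := exists_fin_sum_of_mem_smul_convexHull hs hw
    exact ⟨n, t, m, hn, ht, hm, (abs_le'.1 hvw).2, (abs_le'.1 hvw).1, rfl⟩

theorem pM_nonneg (hM : M.Nonempty) (v : E) : 0 ≤ pM M v := by
  rw [pM_eq_sInf hM]
  exact Real.sInf_nonneg fun _ h => h.1

theorem pM_le (hM : M.Nonempty) {s : ℝ} {v w : E} (hs : 0 ≤ s) (hw : w ∈ s • convexHull ℝ M)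
    (hvw : |v| ≤ w) : pM M v ≤ s := by
  rw [pM_eq_sInf hM]
  exact csInf_le ⟨0, fun _ h => h.1⟩ ⟨hs, w, hw, hvw⟩

theorem exists_mem_smul_convexHull_of_pM_lt (hM : M.Nonempty) {v : E} (hv : v ∈ EMaj M) {r : ℝ}
    (hr : pM M v < r) : ∃ s < r, 0 ≤ s ∧ ∃ w ∈ s • convexHull ℝ M, |v| ≤ w := by
  obtain ⟨_, ⟨t, c, ht, hc, -, rfl⟩, hv₁, hv₂⟩ := hv
  have hne : {s : ℝ | 0 ≤ s ∧ ∃ w ∈ s • convexHull ℝ M, |v| ≤ w}.Nonempty :=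
    ⟨t, ht, t • c, Set.smul_mem_smul_set hc, abs_le'.2 ⟨hv₂, hv₁⟩⟩
  rw [pM_eq_sInf hM] at hr
  obtain ⟨s, hs, hsr⟩ := exists_lt_of_csInf_lt hne hr
  exact ⟨s, hsr, hs⟩

variable [HasSolidNorm E] [IsOrderedAddMonoid E]

/-- If the convex hull of `M` is `p_{M̅}`-closed, then every series sum of mass `s` already lies
in `s • convexHull ℝ M`. -/
theorem IsSeriesSum.mem_smul_convexHull [IsStrictOrderedModule ℝ E] [CompleteSpace E]
    (hM : IsPositiveSubset M) (hbdd : ∃ C : ℝ, ∀ m ∈ M, ‖m‖ ≤ C)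
    (hclosed : ∀ v ∈ EMbar M,
      (∀ ε : ℝ, 0 < ε → ∃ c ∈ convexHull ℝ M, pMbar M (v - c) < ε) → v ∈ convexHull ℝ M)
    {s : ℝ} {w : E} (h : IsSeriesSum M s w) : w ∈ s • convexHull ℝ M := by
  obtain ⟨C, hC⟩ := hbdd
  obtain ⟨t, m, ht, hm, hts, htm⟩ := h
  have hco : ∀ j, m j ∈ convexHull ℝ M := fun j => subset_convexHull ℝ M (hm j)
  rcases (hts.nonneg ht).eq_or_lt with rfl | hs
  · have ht0 : t = 0 := (hasSum_zero_iff_of_nonneg ht).1 hts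
    have hw0 : w = 0 := htm.unique (by simp [ht0, hasSum_zero])
    exact ⟨m 0, hco 0, by simp [hw0]⟩
  have hmul : ∀ j, (s⁻¹ * t j) • m j = s⁻¹ • t j • m j := fun j => mul_smul _ _ _
  have hw : 0 ≤ w := htm.nonneg fun j => smul_nonneg (ht j) (hM.2.1 _ (hm j))
  have hs' : 0 ≤ s⁻¹ := inv_nonneg.2 hs.le
  refine (Set.mem_smul_set_iff_inv_smul_mem₀ hs.ne' _ _).2 (hclosed _ ⟨s⁻¹ • w, ?_, ?_⟩ ?_)
  · refine mem_MbarSet_iff.2 ⟨s⁻¹ * s, fun j => s⁻¹ * t j, m, fun j => mul_nonneg hs' (ht j), hm,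
      hts.mul_left _, ?_⟩
    simpa only [hmul] using htm.const_smul s⁻¹
  · exact (abs_of_nonneg (smul_nonneg hs' hw)).le
  intro ε hε
  set tail : ℕ → ℝ := fun n => s - ∑ j ∈ Finset.range n, t j with htail
  have htail0 : Tendsto (fun n => 2 * (s⁻¹ * tail n)) atTop (𝓝 0) := by
    simpa using ((hts.tendsto_sum_nat.const_sub s).const_mul s⁻¹).const_mul (2 : ℝ)
  obtain ⟨n, hn⟩ := (htail0.eventually_lt_const hε).exists
  have htn : 0 ≤ tail n := sub_nonneg.2 (sum_le_hasSum _ (fun j _ => ht j) hts)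
  have hsumt : HasSum (fun k => t (k + n)) (tail n) := (hasSum_nat_add_iff' n).2 hts
  have hsumm : HasSum (fun k => t (k + n) • m (k + n)) (w - ∑ j ∈ Finset.range n, t j • m j) :=
    (hasSum_nat_add_iff' n).2 htm
  have hR : 0 ≤ w - ∑ j ∈ Finset.range n, t j • m j :=
    hsumm.nonneg fun j => smul_nonneg (ht _) (hM.2.1 _ (hm _))
  refine ⟨s⁻¹ • (∑ j ∈ Finset.range n, t j • m j + tail n • m 0), ?_, lt_of_le_of_lt
    (pMbar_le (w := s⁻¹ • (w - ∑ j ∈ Finset.range n, t j • m j + tail n • m 0)) ?_ ?_) hn⟩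
  · rw [← Set.mem_smul_set_iff_inv_smul_mem₀ hs.ne']
    have hsplit : s = ∑ j ∈ Finset.range n, t j + tail n := by simp [htail]
    rw [hsplit, (convex_convexHull ℝ M).add_smul (Finset.sum_nonneg fun j _ => ht j) htn]
    exact Set.add_mem_add (sum_smul_mem_smul_convexHull hM.1 _ ht hm)
      (Set.smul_mem_smul_set (hco 0))
  · refine IsSeriesSum.hasSum hC (fun k => ?_) ((hsumt.mul_left s⁻¹).mul_left 2)
      ((hsumm.add (hsumt.smul_const (m 0))).const_smul s⁻¹)
    have hk : 0 ≤ s⁻¹ * t (k + n) := mul_nonneg hs' (ht _)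
    refine IsSeriesSum.of_mem_smul_convexHull (by positivity) ?_
    rw [two_mul, (convex_convexHull ℝ M).add_smul hk hk, smul_add, ← mul_smul, ← mul_smul]
    exact Set.add_mem_add (Set.smul_mem_smul_set (hco _)) (Set.smul_mem_smul_set (hco _))
  · have hm0 : 0 ≤ tail n • m 0 := smul_nonneg htn (hM.2.1 _ (hm 0))
    rw [← smul_sub, abs_le', ← smul_neg]
    refine ⟨smul_le_smul_of_nonneg_left ?_ hs', smul_le_smul_of_nonneg_left ?_ hs'⟩
    · rw [← sub_sub, sub_eq_add_neg]
      exact add_le_add_right ((neg_nonpos.2 hm0).trans hm0) _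
    · rw [← sub_sub, neg_sub, sub_eq_add_neg, add_comm]
      exact add_le_add_left ((neg_nonpos.2 hR).trans hR) _

end BanachLattice

/-- Let `E` be a Banach lattice and `M` a positive uniformly bounded subset
such that the convex hull of `M` is `p_{M̅}`-closed in `E_{M̅}`. Then `C_M = M̅`,
`E_M = E_{M̅}`, `p_M = p_{M̅}`, and hence `(E_M, p_M)` is a Banach lattice (every absolutely
`p_M`-summable series in `E_M` converges in the `p_M`-norm to an element of `E_M`). -/
theorem EMaj_Banach_lattice_of_closed_hull
    {E : Type*} [NormedAddCommGroup E] [Lattice E] [HasSolidNorm E] [IsOrderedAddMonoid E]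
    [NormedSpace ℝ E] [IsStrictOrderedModule ℝ E]
    [CompleteSpace E]
    (M : Set E) (hM : IsPositiveSubset M)
    (hbdd : ∃ C : ℝ, ∀ m ∈ M, ‖m‖ ≤ C)
    (hclosed : ∀ v ∈ EMbar M,
      (∀ ε : ℝ, 0 < ε → ∃ c ∈ convexHull ℝ M, pMbar M (v - c) < ε) →
      v ∈ convexHull ℝ M) :
    coneGen M = MbarSet M ∧
    EMaj M = EMbar M ∧
    (∀ v ∈ EMaj M, pM M v = pMbar M v) ∧
    (∀ x : ℕ → E, (∀ k, x k ∈ EMaj M) → Summable (fun k => pM M (x k)) →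
      ∃ l ∈ EMaj M, Filter.Tendsto
        (fun n => pM M ((∑ k ∈ Finset.range n, x k) - l)) Filter.atTop (nhds 0)) := by
  have hmem {s : ℝ} {w : E} (h : IsSeriesSum M s w) :=
    h.mem_smul_convexHull hM hbdd hclosed
  have hcone : coneGen M = MbarSet M := by
    ext w
    rw [mem_MbarSet_iff]
    constructor
    · rintro ⟨s, c, hs, hc, -, rfl⟩
      exact ⟨s, IsSeriesSum.of_mem_smul_convexHull hs (Set.smul_mem_smul_set hc)⟩
    · rintro ⟨s, h⟩
      exact smul_convexHull_subset_coneGen hM h.nonneg (hmem h)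
  refine ⟨hcone, ?_, fun v _ => ?_, fun x hx hsum => ?_⟩
  · ext v
    simp only [EMaj, EMbar, hcone, Set.mem_ofPred_eq, abs_le', and_comm]
  · rw [pM_eq_sInf hM.1, pMbar_eq_sInf]
    congr 1
    ext s
    constructor
    · rintro ⟨hs, w, hw, hvw⟩
      exact ⟨w, .of_mem_smul_convexHull hs hw, hvw⟩
    · rintro ⟨w, h, hvw⟩
      exact ⟨h.nonneg, w, hmem h, hvw⟩
  obtain ⟨C, hC⟩ := hbdd
  have hCco : convexHull ℝ M ⊆ Metric.closedBall 0 C :=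
    convexHull_min (fun m hm => by simpa using hC m hm) (convex_closedBall 0 C)
  have hlt : ∀ k, pM M (x k) < pM M (x k) + (1 / 2 : ℝ) ^ k := fun k =>
    lt_add_of_pos_right _ (by positivity)
  choose s hs hs0 w hw hxw using fun k => exists_mem_smul_convexHull_of_pM_lt hM.1 (hx k) (hlt k)
  have hsums : Summable s :=
    .of_nonneg_of_le hs0 (fun k => (hs k).le) (hsum.add summable_geometric_two)
  have hwnorm : ∀ k, ‖w k‖ ≤ s k * C := by
    intro k
    obtain ⟨c, hc, hcw⟩ := hw k
    rw [← hcw, norm_smul, Real.norm_of_nonneg (hs0 k)]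
    exact mul_le_mul_of_nonneg_left (by simpa using hCco hc) (hs0 k)
  have hsumw : Summable w := .of_norm_bounded (hsums.mul_right C) hwnorm
  have hsumx : Summable x := .of_norm_bounded (hsums.mul_right C) fun k =>
    (norm_le_norm_of_abs_le_abs ((hxw k).trans (le_abs_self _))).trans (hwnorm k)
  have hseries (n : ℕ) : IsSeriesSum M (∑' k, s (k + n)) (∑' k, w (k + n)) :=
    IsSeriesSum.hasSum hC (fun k => .of_mem_smul_convexHull (hs0 _) (hw (k + n)))
      ((summable_nat_add_iff n).2 hsums).hasSum ((summable_nat_add_iff n).2 hsumw).hasSum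
  have hle (n : ℕ) : |∑' k, x (k + n)| ≤ ∑' k, w (k + n) := by
    have hx' := ((summable_nat_add_iff n).2 hsumx).hasSum
    have hw' := ((summable_nat_add_iff n).2 hsumw).hasSum
    exact abs_le'.2 ⟨hasSum_le (fun k => (abs_le'.1 (hxw _)).1) hx' hw',
      hasSum_le (fun k => (abs_le'.1 (hxw _)).2) hx'.neg hw'⟩
  refine ⟨∑' k, x k, ⟨∑' k, w k, smul_convexHull_subset_coneGen hM (hseries 0).nonneg
    (hmem (hseries 0)), (abs_le'.1 (hle 0)).2, (abs_le'.1 (hle 0)).1⟩, ?_⟩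
  refine squeeze_zero (fun n => pM_nonneg hM.1 _) (fun n => ?_) (tendsto_sum_nat_add s)
  refine pM_le hM.1 (hseries n).nonneg (hmem (hseries n)) ?_
  rw [← hsumx.sum_add_tsum_nat_add n, sub_add_cancel_left, abs_neg]
  exact hle n
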